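/- Let G be a connected finite simple graph with maximum degree Δ ≥ 2. Then the zero forcing number satisfies Z(G) = F_1(G) ≤ ((Δ - 2)·n + 2) / (Δ - 1), where n is the number of vertices of G. -/

import Mathlib

open Finset SimpleGraph

/-- One round of the `k`-forcing color change rule: to the currently colored set `C` we add
every vertex `w` having a colored neighbor `v` with at most `k` non-colored neighbors. -/
def kForceStep {V : Type*} [Fintype V] [DecidableEq V] (G : SimpleGraph V)
    [DecidableRel G.Adj] (k : ℕ) (C : Finset V) : Finset V :=
  C ∪ Finset.univ.filter (fun w =>
    ∃ v ∈ C, G.Adj v w ∧ ((G.neighborFinset v) \ C).card ≤ k)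

/-- `S` is a `k`-forcing set: iterating the color change rule starting from `S`
eventually colors all vertices. -/
def IsKForcingSet {V : Type*} [Fintype V] [DecidableEq V] (G : SimpleGraph V)
    [DecidableRel G.Adj] (k : ℕ) (S : Finset V) : Prop :=
  (kForceStep G k)^[Fintype.card V] S = Finset.univ

/-- The `k`-forcing number: the minimum cardinality of a `k`-forcing set. -/
noncomputable def kForcingNumber {V : Type*} [Fintype V] [DecidableEq V] (G : SimpleGraph V)
    [DecidableRel G.Adj] (k : ℕ) : ℕ :=
  sInf {m | ∃ S : Finset V, IsKForcingSet G k S ∧ S.card = m}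

section Forcing

variable {V : Type*} [Fintype V] [DecidableEq V] (G : SimpleGraph V) [DecidableRel G.Adj]

theorem subset_kForceStep (k : ℕ) (C : Finset V) : C ⊆ kForceStep G k C :=
  Finset.subset_union_left

theorem kForceStep_mono (k : ℕ) : Monotone (kForceStep G k) := by
  intro C D h w hw
  simp only [kForceStep, Finset.mem_union, Finset.mem_filter, Finset.mem_univ, true_and] at hw ⊢
  rcases hw with hw | ⟨v, hv, hvw, hcard⟩
  · exact Or.inl (h hw)
  · exact Or.inr ⟨v, h hv, hvw,
      (Finset.card_le_card (Finset.sdiff_subset_sdiff le_rfl h)).trans hcard⟩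

theorem iterate_kForceStep_mono (k : ℕ) (S : Finset V) {m n : ℕ} (h : m ≤ n) :
    (kForceStep G k)^[m] S ⊆ (kForceStep G k)^[n] S :=
  Function.monotone_iterate_of_id_le (subset_kForceStep G k) h S

/-- Adding to `S` all but one of the uncolored neighbors of a colored vertex `v` makes `v` force
the last one. -/
theorem exists_forcing_neighborFinset {C S : Finset V} {f : ℕ} {v : V}
    (hC : C ⊆ (kForceStep G 1)^[f] S) (hv : v ∈ C) (hN : (G.neighborFinset v \ C).Nonempty) :
    ∃ S' : Finset V, C ∪ G.neighborFinset v ⊆ (kForceStep G 1)^[f + 1] S' ∧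
      S'.card + 1 ≤ S.card + (G.neighborFinset v \ C).card := by
  obtain ⟨w, hw⟩ := hN
  set A := (G.neighborFinset v \ C).erase w with hA
  set D := (kForceStep G 1)^[f] (S ∪ A) with hD
  have hCD : C ⊆ D := hC.trans ((kForceStep_mono G 1).iterate f Finset.subset_union_left)
  have hAD : A ⊆ D :=
    Finset.subset_union_right.trans (iterate_kForceStep_mono G 1 (S ∪ A) (Nat.zero_le f))
  have hrest : ∀ x ∈ G.neighborFinset v, x ≠ w → x ∈ D := by
    intro x hx hxw
    by_cases hxC : x ∈ C
    · exact hCD hxC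
    · exact hAD (Finset.mem_erase.2 ⟨hxw, Finset.mem_sdiff.2 ⟨hx, hxC⟩⟩)
  refine ⟨S ∪ A, ?_, ?_⟩
  · rw [Function.iterate_succ_apply', ← hD]
    refine Finset.union_subset (hCD.trans (subset_kForceStep G 1 D)) fun x hx => ?_
    by_cases hxw : x = w
    · refine Finset.mem_union_right _ (Finset.mem_filter.2 ⟨Finset.mem_univ _, v, hCD hv,
        (G.mem_neighborFinset v x).1 hx, ?_⟩)
      refine (Finset.card_le_card (t := {w}) fun y hy => ?_).trans (Finset.card_singleton w).le
      rw [Finset.mem_sdiff] at hy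
      by_contra hyw
      exact hy.2 (hrest y hy.1 (by simpa using hyw))
    · exact subset_kForceStep G 1 D (hrest x hx hxw)
  · have h₁ := Finset.card_union_le S A
    have h₂ : A.card + 1 = _ := Finset.card_erase_add_one hw
    omega

/-- A nonempty set of colored vertices inducing no isolated vertex, forced by `S` in `f` steps each
of which colors at most `Δ - 1` new vertices, can be grown to the whole graph. -/
theorem exists_forcing_univ (hconn : G.Connected) (C S : Finset V) (f : ℕ) (hne : C.Nonempty)
    (hC : C ⊆ (kForceStep G 1)^[f] S) (hS : S.card + f ≤ C.card)
    (hcard : C.card ≤ 2 + (G.maxDegree - 1) * f) (hadj : ∀ v ∈ C, ∃ u ∈ C, G.Adj v u) :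
    ∃ (T : Finset V) (g : ℕ), (kForceStep G 1)^[g] T = Finset.univ ∧
      T.card + g ≤ Fintype.card V ∧ Fintype.card V ≤ 2 + (G.maxDegree - 1) * g := by
  induction h : Cᶜ.card using Nat.strong_induction_on generalizing C S f with
  | _ m ih =>
    by_cases hCu : C = Finset.univ
    · subst hCu
      exact ⟨S, f, Finset.univ_subset_iff.1 hC, by simpa using hS, by simpa using hcard⟩
    obtain ⟨v, hv, w, hvw, hw⟩ : ∃ v ∈ C, ∃ w, G.Adj v w ∧ w ∉ C := by
      by_contra! hclosed
      obtain ⟨a, ha⟩ := hne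
      refine hCu (Finset.eq_univ_iff_forall.2 fun b => ?_)
      obtain ⟨p⟩ := hconn.preconnected a b
      induction p with
      | nil => exact ha
      | cons hab _ ihp => exact ihp (hclosed _ ha _ hab)
    have hwN : w ∈ G.neighborFinset v \ C := by simp [hvw, hw]
    obtain ⟨S', hS', hS'card⟩ := exists_forcing_neighborFinset G hC hv ⟨w, hwN⟩
    have hunion : (C ∪ G.neighborFinset v).card = C.card + (G.neighborFinset v \ C).card := by
      rw [← Finset.union_sdiff_self_eq_union, Finset.card_union_of_disjoint Finset.disjoint_sdiff]
    have hnew : (G.neighborFinset v \ C).card + 1 ≤ G.maxDegree := by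
      obtain ⟨u, hu, hvu⟩ := hadj v hv
      refine le_trans ?_ (G.degree_le_maxDegree v)
      rw [← G.card_neighborFinset_eq_degree]
      refine Finset.card_lt_card (Finset.ssubset_iff_of_subset Finset.sdiff_subset |>.2 ⟨u, ?_⟩)
      simp [hvu, hu]
    refine ih _ ?_ (C ∪ G.neighborFinset v) S' (f + 1) ⟨v, Finset.mem_union_left _ hv⟩ hS'
      (by omega) ?_ ?_ rfl
    · rw [← h]
      refine Finset.card_lt_card (Finset.compl_ssubset_compl.2 ?_)
      exact Finset.ssubset_iff_of_subset Finset.subset_union_left |>.2 ⟨w, by simp [hvw], hw⟩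
    · rw [hunion, Nat.mul_succ]
      omega
    · intro x hx
      rcases Finset.mem_union.1 hx with hx | hx
      · obtain ⟨u, hu, hxu⟩ := hadj x hx
        exact ⟨u, Finset.mem_union_left _ hu, hxu⟩
      · exact ⟨v, Finset.mem_union_left _ hv, ((G.mem_neighborFinset v x).1 hx).symm⟩

end Forcing

/-- Corollary: If `G` is connected with maximum degree `Δ ≥ 2`, then the
zero forcing number satisfies `Z(G) = F_1(G) ≤ ((Δ - 2) n + 2) / (Δ - 1)`. -/
theorem zeroForcingNumber_le_of_connected {V : Type*} [Fintype V] [DecidableEq V]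
    (G : SimpleGraph V) [DecidableRel G.Adj]
    (hconn : G.Connected) (hΔ : 2 ≤ G.maxDegree) :
    (kForcingNumber G 1 : ℝ) ≤
      (((G.maxDegree : ℝ) - 2) * (Fintype.card V) + 2) / ((G.maxDegree : ℝ) - 1) := by
  have := hconn.nonempty
  obtain ⟨v, hv⟩ := G.exists_maximal_degree_vertex
  have hdeg : (G.neighborFinset v).card = G.maxDegree := by
    rw [G.card_neighborFinset_eq_degree, hv]
  have hsdiff : G.neighborFinset v \ {v} = G.neighborFinset v := by simp
  have hNne : (G.neighborFinset v).Nonempty := Finset.card_pos.1 (by omega)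
  obtain ⟨S, hS, hScard⟩ := exists_forcing_neighborFinset G (f := 0) (C := {v}) (S := {v})
    (v := v) (by simp) (by simp) (hsdiff.symm ▸ hNne)
  have hcard : ({v} ∪ G.neighborFinset v).card = G.maxDegree + 1 := by
    rw [Finset.card_union_of_disjoint (by simp), hdeg, Finset.card_singleton, add_comm]
  rw [hsdiff, hdeg, Finset.card_singleton] at hScard
  obtain ⟨T, g, hT, hTcard, hn⟩ := exists_forcing_univ G hconn ({v} ∪ G.neighborFinset v) S 1
    ⟨v, by simp⟩ hS (by omega) (by omega) (by
      intro x hx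
      rcases Finset.mem_union.1 hx with hx | hx
      · obtain rfl := Finset.mem_singleton.1 hx
        obtain ⟨u, hu⟩ := hNne
        exact ⟨u, Finset.mem_union_right _ hu, (G.mem_neighborFinset x u).1 hu⟩
      · exact ⟨v, by simp, ((G.mem_neighborFinset v x).1 hx).symm⟩)
  have hforcing : IsKForcingSet G 1 T :=
    Finset.univ_subset_iff.1 (hT ▸ iterate_kForceStep_mono G 1 T (by omega))
  have hle : kForcingNumber G 1 ≤ T.card := Nat.sInf_le ⟨T, hforcing, rfl⟩
  have hsum : (kForcingNumber G 1 : ℝ) + g ≤ Fintype.card V := by exact_mod_cast (by omega)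
  have hn' : (Fintype.card V : ℝ) ≤ 2 + ((G.maxDegree : ℝ) - 1) * g := by
    have : ((G.maxDegree - 1 : ℕ) : ℝ) = (G.maxDegree : ℝ) - 1 := by
      rw [Nat.cast_sub (by omega), Nat.cast_one]
    rw [← this]
    exact_mod_cast hn
  have hΔ' : (2 : ℝ) ≤ G.maxDegree := by exact_mod_cast hΔ
  rw [le_div_iff₀ (by linarith)]
  nlinarith
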